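/- There are exactly two suitably connected 2-mosaics: the mosaic all four of whose tiles are the empty tile T0, and the mosaic forming a single circle, whose four tiles are the four arc tiles placed so that each arc connects its two inward-facing edges (the tile in position (1,1) has connection points {bottom,right}, position (1,2) has {bottom,left}, position (2,1) has {top,right}, and position (2,2) has {top,left}). -/

import Mathlib

/-- The 15 mosaic tiles. -/
inductive Tile where
  | T0 | T1 | T2 | T3 | T4 | T5 | T6 | T7 | T8 | T9 | T10 | T11 | T12 | T13 | T14
  deriving DecidableEq

instance : Fintype Tile where
  elems := Finset.mk
    ([.T0, .T1, .T2, .T3, .T4, .T5, .T6, .T7, .T8, .T9, .T10, .T11, .T12, .T13, .T14] : List Tile)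
    (by decide)
  complete := by
    intro x
    cases x <;> decide

namespace Tile

/-- Whether a tile has a connection point on its top edge. -/
def top : Tile → Bool
  | T3 | T4 | T6 | T7 | T8 | T9 | T10 | T11 | T12 | T13 | T14 => true
  | _ => false

/-- Whether a tile has a connection point on its bottom edge. -/
def bottom : Tile → Bool
  | T1 | T2 | T6 | T7 | T8 | T9 | T10 | T11 | T12 | T13 | T14 => true
  | _ => false

/-- Whether a tile has a connection point on its left edge. -/
def left : Tile → Bool
  | T1 | T4 | T5 | T7 | T8 | T9 | T10 | T11 | T12 | T13 | T14 => true
  | _ => false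

/-- Whether a tile has a connection point on its right edge. -/
def right : Tile → Bool
  | T2 | T3 | T5 | T7 | T8 | T9 | T10 | T11 | T12 | T13 | T14 => true
  | _ => false

end Tile

/-- An (m,n)-mosaic (rows indexed by `Fin m`, columns by `Fin n`) is suitably connected if
every connection point of every tile coincides with a connection point of a contiguous tile. -/
def SuitablyConnected {m n : ℕ} (M : Fin m → Fin n → Tile) : Prop :=
  ∀ (i : Fin m) (j : Fin n),
    ((M i j).top = true → ∃ i' : Fin m, i'.val + 1 = i.val ∧ (M i' j).bottom = true) ∧
    ((M i j).bottom = true → ∃ i' : Fin m, i.val + 1 = i'.val ∧ (M i' j).top = true) ∧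
    ((M i j).left = true → ∃ j' : Fin n, j'.val + 1 = j.val ∧ (M i j').right = true) ∧
    ((M i j).right = true → ∃ j' : Fin n, j.val + 1 = j'.val ∧ (M i j').left = true)

theorem tile_cases (t : Tile) :
    (t.top = false → t.left = false → t = .T0 ∨ t = .T2) ∧
    (t.top = false → t.right = false → t = .T0 ∨ t = .T1) ∧
    (t.bottom = false → t.left = false → t = .T0 ∨ t = .T3) ∧
    (t.bottom = false → t.right = false → t = .T0 ∨ t = .T4) := by
  cases t <;> simp [Tile.top, Tile.left, Tile.right, Tile.bottom]

/-- There are exactly two suitably connected 2-mosaics: the all-empty mosaic and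
the single-circle mosaic whose four tiles are the four arc tiles, placed so that each arc
connects its two inward-facing edges. -/
theorem suitablyConnected_two_mosaics :
    {M : Fin 2 → Fin 2 → Tile | SuitablyConnected M} =
      {(fun _ _ => Tile.T0),
       ![![Tile.T2, Tile.T1], ![Tile.T3, Tile.T4]]} ∧
    (fun _ _ => Tile.T0) ≠ ![![Tile.T2, Tile.T1], ![Tile.T3, Tile.T4]] := by
  constructor
  · ext M
    simp only [Set.mem_setOf_eq, Set.mem_insert_iff, Set.mem_singleton_iff]
    constructor
    · intro h
      have h00 := h 0 0
      have h01 := h 0 1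
      have h10 := h 1 0
      have h11 := h 1 1
      simp only [Fin.exists_fin_two] at h00 h01 h10 h11
      simp at h00 h01 h10 h11
      have a := (tile_cases (M 0 0)).1 h00.1 h00.2.2.1
      have b := (tile_cases (M 0 1)).2.1 h01.1 h01.2.2.2
      have c := (tile_cases (M 1 0)).2.2.1 h10.2.1 h10.2.2.1
      have d := (tile_cases (M 1 1)).2.2.2 h11.2.1 h11.2.2.2
      simp only [funext_iff, Fin.forall_fin_two]
      rcases a with a | a <;> rcases b with b | b <;> rcases c with c | c <;>
        rcases d with d | d <;>
        simp_all [Tile.top, Tile.left, Tile.right, Tile.bottom]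
    · rintro (rfl | rfl)
      · intro i j
        simp [Tile.top, Tile.left, Tile.right, Tile.bottom]
      · unfold SuitablyConnected
        decide
  · intro h
    have := congrFun (congrFun h 0) 0
    simp at this
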